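/- (a) There exists a martingale f ∈ H_{1/2} such that sup_{n≥1} ‖σ_n f‖_{L_{1/2}(μ)} = +∞. (b) For every 0 < p < 1/2 there exists a martingale f ∈ H_p such that sup_{n≥1} ‖σ_n f‖_{weak-L_p} = +∞. -/

import Mathlib

open MeasureTheory Complex Finset
open scoped BigOperators ENNReal NNReal

noncomputable section

instance (n : ℕ) : MeasurableSpace (ZMod n) := ⊤

/-- The Vilenkin group determined by the generating sequence `m`. -/
abbrev Gm (m : ℕ → ℕ) : Type := ∀ _k : ℕ, ZMod (m _k)

namespace Vilenkin

variable (m : ℕ → ℕ)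

/-- The generalized powers `M_0 = 1`, `M_{k+1} = m_k · M_k`. -/
def M : ℕ → ℕ
  | 0 => 1
  | k + 1 => m k * M k

/-- The `j`-th digit `n_j` of `n` in the generalized number system based on `m`. -/
def digit (n j : ℕ) : ℕ := n / M m j % m j

/-- `|n|`, the index of the highest nonzero digit of `n`. -/
def hi (n : ℕ) : ℕ := Nat.findGreatest (fun j => digit m n j ≠ 0) n

/-- `⟨n⟩`, the index of the lowest nonzero digit of `n`. -/
def lo (n : ℕ) : ℕ := sInf {j | digit m n j ≠ 0}

/-- The generalized Rademacher functions `r_k(x) = exp(2πi x_k / m_k)`. -/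
def rad (k : ℕ) (x : Gm m) : ℂ :=
  Complex.exp (2 * Real.pi * Complex.I * ((x k).val : ℂ) / (m k : ℂ))

/-- The Vilenkin functions `ψ_n = ∏_k r_k^{n_k}`. -/
def vil (n : ℕ) (x : Gm m) : ℂ :=
  ∏ k ∈ Finset.range (n + 1), rad m k x ^ digit m n k

/-- The Dirichlet kernels `D_n = ∑_{k=0}^{n-1} ψ_k`. -/
def D (n : ℕ) (x : Gm m) : ℂ := ∑ k ∈ Finset.range n, vil m k x

/-- The Fejér kernels `K_n = (1/n) ∑_{k=1}^{n} D_k`. -/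
def K (n : ℕ) (x : Gm m) : ℂ := (n : ℂ)⁻¹ * ∑ k ∈ Finset.range n, D m (k + 1) x

/-- The Nörlund kernels `F_n = (1/Q_n) ∑_{k=1}^{n} q_{n-k} D_k` where
`Q_n = ∑_{k=0}^{n-1} q_k`. -/
def FK (q : ℕ → ℝ) (n : ℕ) (x : Gm m) : ℂ :=
  ((∑ k ∈ Finset.range n, q k : ℝ) : ℂ)⁻¹ *
    ∑ k ∈ Finset.range n, (q (n - (k + 1)) : ℂ) * D m (k + 1) x

/-- The cylinder subgroup `I_n = {x : x_0 = … = x_{n-1} = 0}`. -/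
def I (n : ℕ) : Set (Gm m) := {x | ∀ k < n, x k = 0}

/-- The cylinder of length `n` around `x`. -/
def cylAt (n : ℕ) (x : Gm m) : Set (Gm m) := {y | ∀ k < n, y k = x k}

/-- `μ` is the normalized Haar measure of `G_m`: the (unique) Borel probability
measure giving each cylinder of length `n` measure `1 / M_n`. -/
def IsHaar (μ : Measure (Gm m)) : Prop :=
  ∀ (n : ℕ) (x : Gm m), μ (cylAt m n x) = (M m n : ℝ≥0∞)⁻¹

/-- A martingale with respect to the filtration `(ℱ_n)` on `G_m`, where `ℱ_n` is
generated by the first `n` coordinates: each `f n` is integrable and depends only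
on the first `n` coordinates, and the conditional expectation of `f N` with
respect to `ℱ_n` (which under the Haar measure is given by averaging over the
cylinders of length `n`) equals `f n` for `n ≤ N`. -/
structure IsMartingale (μ : Measure (Gm m)) (f : ℕ → Gm m → ℂ) : Prop where
  integrable : ∀ n, Integrable (f n) μ
  adapted : ∀ (n : ℕ) (x y : Gm m), (∀ k < n, x k = y k) → f n x = f n y
  mart : ∀ n N : ℕ, n ≤ N → ∀ x : Gm m,
    f n x = (M m n : ℂ) * ∫ t in cylAt m n x, f N t ∂μ

/-- The Vilenkin–Fourier coefficients of a martingale: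
`f̂(i) = lim_k ∫ f^(k) conj(ψ_i) dμ`; for a martingale these integrals are
constant as soon as `M_k > i`, in particular from `k = i + 1` on. -/
def coeff (μ : Measure (Gm m)) (f : ℕ → Gm m → ℂ) (i : ℕ) : ℂ :=
  ∫ x, f (i + 1) x * (starRingEnd ℂ) (vil m i x) ∂μ

/-- The partial sums `S_n f = ∑_{k=0}^{n-1} f̂(k) ψ_k`. -/
def S (μ : Measure (Gm m)) (f : ℕ → Gm m → ℂ) (n : ℕ) (x : Gm m) : ℂ :=
  ∑ k ∈ Finset.range n, coeff m μ f k * vil m k x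

/-- The Fejér means `σ_n f = (1/n) ∑_{k=1}^{n} S_k f`. -/
def sigma (μ : Measure (Gm m)) (f : ℕ → Gm m → ℂ) (n : ℕ) (x : Gm m) : ℂ :=
  (n : ℂ)⁻¹ * ∑ k ∈ Finset.range n, S m μ f (k + 1) x

/-- The Nörlund means `t_n f = (1/Q_n) ∑_{k=1}^{n} q_{n-k} S_k f`. -/
def T (μ : Measure (Gm m)) (q : ℕ → ℝ) (f : ℕ → Gm m → ℂ) (n : ℕ) (x : Gm m) : ℂ :=
  ((∑ k ∈ Finset.range n, q k : ℝ) : ℂ)⁻¹ *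
    ∑ k ∈ Finset.range n, (q (n - (k + 1)) : ℂ) * S m μ f (k + 1) x

/-- The martingale maximal function `f* = sup_n |f^(n)|`. -/
def mstar (f : ℕ → Gm m → ℂ) (x : Gm m) : ℝ≥0∞ := ⨆ n, (‖f n x‖₊ : ℝ≥0∞)

/-- The `L_p`-type quasi-norm `(∫ g^p dμ)^{1/p}` of an `ℝ≥0∞`-valued function. -/
def eLp (μ : Measure (Gm m)) (p : ℝ) (g : Gm m → ℝ≥0∞) : ℝ≥0∞ :=
  (∫⁻ x, g x ^ p ∂μ) ^ (1 / p)

/-- Membership in the martingale Hardy space `H_p`: `‖f‖_{H_p} = ‖f*‖_{L_p} < ∞`. -/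
def MemHp (μ : Measure (Gm m)) (p : ℝ) (f : ℕ → Gm m → ℂ) : Prop :=
  eLp m μ p (mstar m f) ≠ ⊤

/-- The weak-`L_p` quasi-norm `sup_{t>0} t · μ(g > t)^{1/p}`. -/
def wLp (μ : Measure (Gm m)) (p : ℝ) (g : Gm m → ℝ≥0∞) : ℝ≥0∞ :=
  ⨆ t : ℝ≥0, (t : ℝ≥0∞) * μ {x | (t : ℝ≥0∞) < g x} ^ (1 / p)

end Vilenkin

namespace Vilenkin

variable {m : ℕ → ℕ}

section Arithmetic

lemma M_pos (hm : ∀ k, 2 ≤ m k) (n : ℕ) : 0 < M m n := by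
  induction n with
  | zero => simp [M]
  | succ k ih => exact Nat.mul_pos (by have := hm k; omega) ih

lemma two_mul_M_le (hm : ∀ k, 2 ≤ m k) (n : ℕ) : 2 * M m n ≤ M m (n + 1) :=
  Nat.mul_le_mul_right _ (hm n)

lemma M_mono (hm : ∀ k, 2 ≤ m k) : Monotone (M m) :=
  monotone_nat_of_le_succ fun n => by have := two_mul_M_le hm n; omega

lemma two_pow_le_M (hm : ∀ k, 2 ≤ m k) (n : ℕ) : 2 ^ n ≤ M m n := by
  induction n with
  | zero => simp [M]
  | succ k ih => have := two_mul_M_le hm k; rw [pow_succ]; omega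

lemma lt_M (hm : ∀ k, 2 ≤ m k) (n : ℕ) : n < M m n :=
  Nat.lt_two_pow_self.trans_le (two_pow_le_M hm n)

lemma M_dvd_M {k n : ℕ} (h : k ≤ n) : M m k ∣ M m n := by
  induction n, h using Nat.le_induction with
  | base => exact dvd_rfl
  | succ n _ ih => exact ih.mul_left _

lemma digit_eq_zero (hm : ∀ k, 2 ≤ m k) {n N k : ℕ} (hn : n < M m N) (hk : N ≤ k) :
    digit m n k = 0 := by
  rw [digit, Nat.div_eq_of_lt (hn.trans_le (M_mono hm hk)), Nat.zero_mod]

lemma digit_add_self {N c j : ℕ} (hj : j < M m N) (hc : c < m N) :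
    digit m (c * M m N + j) N = c := by
  have h0 : 0 < M m N := by omega
  rw [digit, Nat.add_comm, Nat.add_mul_div_right _ _ h0, Nat.div_eq_of_lt hj, Nat.zero_add,
    Nat.mod_eq_of_lt hc]

lemma digit_add_of_lt (hm : ∀ k, 2 ≤ m k) {N c j k : ℕ} (hk : k < N) :
    digit m (c * M m N + j) k = digit m j k := by
  obtain ⟨q, hq⟩ := M_dvd_M (m := m) (Nat.succ_le_of_lt hk)
  have h : c * M m N + j = j + M m k * (m k * (q * c)) := by
    rw [hq, Nat.succ_eq_add_one, M]; ring
  rw [digit, digit, h, Nat.add_mul_div_left _ _ (M_pos hm k), Nat.add_mul_mod_self_left]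

end Arithmetic

section Characters

lemma rad_eq_pow (k : ℕ) (x : Gm m) :
    rad m k x = Complex.exp (2 * Real.pi * Complex.I / (m k : ℂ)) ^ (x k).val := by
  rw [rad, ← Complex.exp_nat_mul]; congr 1; ring

lemma rad_of_eq_zero {k : ℕ} {x : Gm m} (h : x k = 0) : rad m k x = 1 := by
  rw [rad_eq_pow, h, ZMod.val_zero, pow_zero]

lemma norm_rad (k : ℕ) (x : Gm m) : ‖rad m k x‖ = 1 := by
  have : 2 * Real.pi * Complex.I * ((x k).val : ℂ) / (m k : ℂ)
      = ((2 * Real.pi * (x k).val / m k : ℝ) : ℂ) * Complex.I := by push_cast; ring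
  rw [rad, this, Complex.norm_exp_ofReal_mul_I]

lemma rad_update {k a : ℕ} (ha : a < m k) (x : Gm m) :
    rad m k (Function.update x k (a : ZMod (m k)))
      = Complex.exp (2 * Real.pi * Complex.I / (m k : ℂ)) ^ a := by
  have : NeZero (m k) := ⟨by omega⟩
  rw [rad_eq_pow, Function.update_self, ZMod.val_cast_of_lt ha]

lemma geom_sum_eq_zero_of_pow_eq_one {z : ℂ} {n : ℕ} (h1 : z ≠ 1) (hn : z ^ n = 1) :
    ∑ c ∈ range n, z ^ c = 0 := by
  have := geom_sum_mul z n
  rw [hn, sub_self] at this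
  exact (mul_eq_zero.1 this).resolve_right (sub_ne_zero.2 h1)

lemma isPrimitiveRoot_rad (hm : ∀ k, 2 ≤ m k) (k : ℕ) :
    IsPrimitiveRoot (Complex.exp (2 * Real.pi * Complex.I / (m k : ℂ))) (m k) :=
  Complex.isPrimitiveRoot_exp _ (by have := hm k; omega)

lemma sum_rad_pow (hm : ∀ k, 2 ≤ m k) {k : ℕ} {x : Gm m} (h : x k ≠ 0) :
    ∑ c ∈ range (m k), rad m k x ^ c = 0 := by
  have : NeZero (m k) := ⟨by have := hm k; omega⟩
  have hp := isPrimitiveRoot_rad hm k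
  refine geom_sum_eq_zero_of_pow_eq_one ?_ ?_
  · rw [rad_eq_pow]
    exact hp.pow_ne_one_of_pos_of_lt (by simpa using h) (ZMod.val_lt _)
  · rw [rad_eq_pow, pow_right_comm, hp.pow_eq_one, one_pow]

lemma sum_update_rad (hm : ∀ k, 2 ≤ m k) {k c d : ℕ} (hc : c < m k) (hd : d < m k)
    (h : c ≠ d) (x : Gm m) :
    ∑ a ∈ range (m k), rad m k (Function.update x k (a : ZMod (m k))) ^ c *
      (starRingEnd ℂ) (rad m k (Function.update x k (a : ZMod (m k)))) ^ d = 0 := by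
  have hp := isPrimitiveRoot_rad hm k
  set ζ := Complex.exp (2 * Real.pi * Complex.I / (m k : ℂ)) with hζ
  have h0 : ζ ≠ 0 := Complex.exp_ne_zero _
  have hconj : (starRingEnd ℂ) ζ = ζ⁻¹ := by
    rw [Complex.inv_eq_conj]
    exact hp.norm'_eq_one (by have := hm k; omega)
  have : ∀ a ∈ range (m k), rad m k (Function.update x k (a : ZMod (m k))) ^ c *
      (starRingEnd ℂ) (rad m k (Function.update x k (a : ZMod (m k)))) ^ d
      = (ζ ^ c * (ζ⁻¹) ^ d) ^ a := by
    intro a ha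
    rw [rad_update (Finset.mem_range.1 ha), ← hζ, map_pow, hconj]
    ring
  rw [Finset.sum_congr rfl this]
  refine geom_sum_eq_zero_of_pow_eq_one ?_ ?_
  · intro h1
    apply h
    apply hp.pow_inj hc hd
    rwa [inv_pow, mul_inv_eq_one₀ (pow_ne_zero _ h0)] at h1
  · rw [mul_pow, ← pow_mul, ← pow_mul, mul_comm c, mul_comm d, pow_mul, pow_mul, inv_pow,
      hp.pow_eq_one]
    simp

lemma vil_eq_prod (hm : ∀ k, 2 ≤ m k) {n N : ℕ} (hn : n < M m N) (x : Gm m) :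
    vil m n x = ∏ k ∈ range N, rad m k x ^ digit m n k := by
  have key : ∀ A B : ℕ, n < M m A → A ≤ B →
      ∏ k ∈ range A, rad m k x ^ digit m n k = ∏ k ∈ range B, rad m k x ^ digit m n k := by
    intro A B hA hAB
    refine Finset.prod_subset (Finset.range_mono hAB) fun k _ hk => ?_
    rw [digit_eq_zero hm hA (by simpa using hk), pow_zero]
  rw [vil, key (n + 1) (max (n + 1) N) ((Nat.lt_succ_self n).trans (lt_M hm _)) (le_max_left _ _),
    key N (max (n + 1) N) hn (le_max_right _ _)]

lemma vil_add (hm : ∀ k, 2 ≤ m k) {N c j : ℕ} (hj : j < M m N) (hc : c < m N) (x : Gm m) :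
    vil m (c * M m N + j) x = rad m N x ^ c * vil m j x := by
  have h : c * M m N + j < M m (N + 1) :=
    calc c * M m N + j < (c + 1) * M m N := by rw [add_mul, one_mul]; omega
      _ ≤ m N * M m N := Nat.mul_le_mul_right _ hc
  rw [vil_eq_prod hm h, Finset.prod_range_succ, digit_add_self hj hc, vil_eq_prod hm hj, mul_comm]
  congr 1
  refine Finset.prod_congr rfl fun k hk => ?_
  rw [digit_add_of_lt hm (Finset.mem_range.1 hk)]

lemma vil_M_add (hm : ∀ k, 2 ≤ m k) {N j : ℕ} (hj : j < M m N) (x : Gm m) :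
    vil m (M m N + j) x = rad m N x * vil m j x := by
  simpa using vil_add hm (c := 1) hj (hm N) x

lemma norm_vil (n : ℕ) (x : Gm m) : ‖vil m n x‖ = 1 := by
  simp [vil, norm_prod, norm_rad]

lemma vil_eq_one (hm : ∀ k, 2 ≤ m k) {k j : ℕ} (hj : j < M m k) {x : Gm m}
    (hx : ∀ i < k, x i = 0) : vil m j x = 1 := by
  rw [vil_eq_prod hm hj]
  refine Finset.prod_eq_one fun i hi => ?_
  rw [rad_of_eq_zero (hx i (Finset.mem_range.1 hi)), one_pow]

/-- The sums `n K_n = ∑_{k=1}^{n} D_k` of the Dirichlet kernels. -/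
def sumD (m : ℕ → ℕ) (n : ℕ) (x : Gm m) : ℂ := ∑ k ∈ range n, D m (k + 1) x

lemma D_add (hm : ∀ k, 2 ≤ m k) {N c j : ℕ} (hj : j ≤ M m N) (hc : c < m N) (x : Gm m) :
    D m (c * M m N + j) x = D m (c * M m N) x + rad m N x ^ c * D m j x := by
  simp only [D]
  rw [Finset.sum_range_add, Finset.mul_sum]
  congr 1
  refine Finset.sum_congr rfl fun i hi => vil_add hm ?_ hc x
  exact (Finset.mem_range.1 hi).trans_le hj

lemma D_mul (hm : ∀ k, 2 ≤ m k) {N c : ℕ} (hc : c ≤ m N) (x : Gm m) :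
    D m (c * M m N) x = (∑ i ∈ range c, rad m N x ^ i) * D m (M m N) x := by
  induction c with
  | zero => simp [D]
  | succ c ih =>
    rw [add_mul, one_mul, D_add hm le_rfl hc, ih (by omega), Finset.sum_range_succ, add_mul]

lemma sumD_add (hm : ∀ k, 2 ≤ m k) {N c t : ℕ} (ht : t ≤ M m N) (hc : c < m N) (x : Gm m) :
    sumD m (c * M m N + t) x
      = sumD m (c * M m N) x + t * D m (c * M m N) x + rad m N x ^ c * sumD m t x := by
  simp only [sumD]
  rw [Finset.sum_range_add, Finset.mul_sum, add_assoc]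
  congr 1
  have h : ∀ i ∈ range t, D m (c * M m N + i + 1) x
      = D m (c * M m N) x + rad m N x ^ c * D m (i + 1) x := fun i hi => by
    rw [add_assoc, D_add hm ((Nat.succ_le_of_lt (Finset.mem_range.1 hi)).trans ht) hc]
  rw [Finset.sum_congr rfl h, Finset.sum_add_distrib, Finset.sum_const, Finset.card_range,
    nsmul_eq_mul]

lemma sumD_mul (hm : ∀ k, 2 ≤ m k) {N c : ℕ} (hc : c ≤ m N) {x : Gm m}
    (hD : D m (M m N) x = 0) :
    sumD m (c * M m N) x = (∑ i ∈ range c, rad m N x ^ i) * sumD m (M m N) x := by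
  induction c with
  | zero => simp [sumD]
  | succ c ih =>
    rw [add_mul, one_mul, sumD_add hm le_rfl hc, ih (by omega), Finset.sum_range_succ, add_mul,
      D_mul hm (by omega), hD]
    ring

lemma D_eq_natCast (hm : ∀ k, 2 ≤ m k) {k j : ℕ} (hj : j ≤ M m k) {x : Gm m}
    (hx : ∀ i < k, x i = 0) : D m j x = j := by
  rw [D, Finset.sum_congr rfl fun i hi => vil_eq_one hm ((Finset.mem_range.1 hi).trans_le hj) hx]
  simp

lemma D_M_eq_zero (hm : ∀ k, 2 ≤ m k) {k n : ℕ} (hk : k < n) {x : Gm m} (hx : x k ≠ 0) :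
    D m (M m n) x = 0 := by
  induction n, hk using Nat.le_induction with
  | base => rw [Nat.succ_eq_add_one, M, D_mul hm le_rfl, sum_rad_pow hm hx, zero_mul]
  | succ n _ ih => rw [M, D_mul hm le_rfl, ih, mul_zero]

lemma sumD_M_eq_zero (hm : ∀ k, 2 ≤ m k) {k n : ℕ} (hk : k + 1 < n) {x : Gm m} (hx : x k ≠ 0)
    (hx' : x (k + 1) ≠ 0) : sumD m (M m n) x = 0 := by
  induction n, hk using Nat.le_induction with
  | base =>
    rw [Nat.succ_eq_add_one, M, sumD_mul hm le_rfl (D_M_eq_zero hm (Nat.lt_succ_self k) hx),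
      sum_rad_pow hm hx', zero_mul]
  | succ n hn ih =>
    rw [M, sumD_mul hm le_rfl (D_M_eq_zero hm (by omega) hx), ih, mul_zero]

lemma D_M_eq_indicator (hm : ∀ k, 2 ≤ m k) (n : ℕ) (x : Gm m) :
    D m (M m n) x = (cylAt m n 0).indicator (fun _ => (M m n : ℂ)) x := by
  by_cases h : x ∈ cylAt m n 0
  · rw [Set.indicator_of_mem h]
    exact D_eq_natCast hm le_rfl h
  · rw [Set.indicator_of_notMem h]
    simp only [cylAt, Set.mem_ofPred_eq, not_forall] at h
    obtain ⟨k, hk, hx⟩ := h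
    exact D_M_eq_zero hm hk hx

/-- The numbers `∑_{i<N} M_{3i}`, at which the Fejér kernels are large in `L_{1/2}`. -/
def sparse (m : ℕ → ℕ) (N : ℕ) : ℕ := ∑ i ∈ range N, M m (3 * i)

lemma sparse_le (hm : ∀ k, 2 ≤ m k) (N : ℕ) : sparse m N ≤ M m (3 * N) := by
  induction N with
  | zero => simp [sparse]
  | succ N ih =>
    rw [sparse, Finset.sum_range_succ, ← sparse]
    have h1 := two_mul_M_le hm (3 * N)
    have h2 : M m (3 * N + 1) ≤ M m (3 * (N + 1)) := M_mono hm (by omega)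
    omega

lemma sparse_succ_le (hm : ∀ k, 2 ≤ m k) (N : ℕ) : sparse m (N + 1) ≤ M m (3 * N + 1) := by
  rw [sparse, Finset.sum_range_succ, ← sparse]
  have h1 := two_mul_M_le hm (3 * N)
  have h2 := sparse_le hm N
  omega

lemma sumD_eq (hm : ∀ k, 2 ≤ m k) {k t : ℕ} (ht : t ≤ M m k) {x : Gm m}
    (hx : ∀ i < k, x i = 0) : sumD m t x = t * (t + 1) / 2 := by
  induction t with
  | zero => simp [sumD]
  | succ t ih =>
    rw [sumD, Finset.sum_range_succ, ← sumD, ih (by omega), D_eq_natCast hm ht hx]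
    push_cast; ring

lemma le_norm_sumD_sparse (hm : ∀ k, 2 ≤ m k) {i N : ℕ} (hi : i < N) {x : Gm m}
    (hx : ∀ j < 3 * i + 1, x j = 0) (hx1 : x (3 * i + 1) ≠ 0) (hx2 : x (3 * i + 2) ≠ 0) :
    (M m (3 * i) : ℝ) ^ 2 / 2 ≤ ‖sumD m (sparse m N) x‖ := by
  induction N, hi using Nat.le_induction with
  | base =>
    have h1 : M m (3 * i) ≤ sparse m (i + 1) := by
      rw [sparse, Finset.sum_range_succ]; omega
    have h2 : (M m (3 * i) : ℝ) ≤ (sparse m (i + 1) : ℝ) := by exact_mod_cast h1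
    rw [Nat.succ_eq_add_one, sumD_eq hm (sparse_succ_le hm i) hx]
    have h3 : ((sparse m (i + 1) : ℂ) * (sparse m (i + 1) + 1) / 2)
      = (((sparse m (i + 1) : ℝ) * (sparse m (i + 1) + 1) / 2 : ℝ) : ℂ) := by push_cast; rfl
    rw [h3, Complex.norm_real, Real.norm_of_nonneg (by positivity)]
    have h4 : (0 : ℝ) ≤ M m (3 * i) := by positivity
    nlinarith
  | succ N hN ih =>
    have h := sumD_add hm (N := 3 * N) (c := 1) (sparse_le hm N) (hm _) x
    rw [one_mul, D_M_eq_zero hm (k := 3 * i + 1) (by omega) hx1,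
      sumD_M_eq_zero hm (k := 3 * i + 1) (by omega) hx1 hx2, mul_zero, add_zero, zero_add,
      pow_one] at h
    rw [sparse, Finset.sum_range_succ, ← sparse, Nat.add_comm, h, norm_mul, norm_rad, one_mul]
    exact ih

end Characters

section Measure

/-- `h` depends only on the first `n` coordinates. -/
def DependsOnFirst (n : ℕ) (h : Gm m → ℂ) : Prop :=
  ∀ x y : Gm m, (∀ k < n, x k = y k) → h x = h y

lemma DependsOnFirst.mul {n : ℕ} {g h : Gm m → ℂ} (hg : DependsOnFirst n g)
    (hh : DependsOnFirst n h) : DependsOnFirst n (fun x => g x * h x) := fun x y hxy => by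
  simp only [hg x y hxy, hh x y hxy]

lemma DependsOnFirst.sum {n : ℕ} {s : Finset ℕ} {g : ℕ → Gm m → ℂ}
    (hg : ∀ j ∈ s, DependsOnFirst n (g j)) : DependsOnFirst n (fun x => ∑ j ∈ s, g j x) :=
  fun x y hxy => Finset.sum_congr rfl fun j hj => hg j hj x y hxy

lemma dependsOnFirst_const (n : ℕ) (c : ℂ) : DependsOnFirst (m := m) n (fun _ => c) :=
  fun _ _ _ => rfl

lemma dependsOnFirst_vil (hm : ∀ k, 2 ≤ m k) {n j : ℕ} (hj : j < M m n) :
    DependsOnFirst n (vil m j) := fun x y hxy => by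
  rw [vil_eq_prod hm hj, vil_eq_prod hm hj]
  refine Finset.prod_congr rfl fun k hk => ?_
  rw [rad, rad, hxy k (Finset.mem_range.1 hk)]

lemma DependsOnFirst.conj {n : ℕ} {h : Gm m → ℂ} (hh : DependsOnFirst n h) :
    DependsOnFirst n (fun x => (starRingEnd ℂ) (h x)) := fun x y hxy => by
  simp only [hh x y hxy]

lemma DependsOnFirst.update {n : ℕ} {h : Gm m → ℂ} (hh : DependsOnFirst n h) (x : Gm m)
    (a : ZMod (m n)) : h (Function.update x n a) = h x :=
  hh _ _ fun _ hk => Function.update_of_ne hk.ne _ _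

lemma measurableSet_cylAt (n : ℕ) (x : Gm m) : MeasurableSet (cylAt m n x) := by
  have : cylAt m n x = ⋂ k : ℕ, ⋂ _ : k < n, (fun y : Gm m => y k) ⁻¹' {x k} := by
    ext y; simp [cylAt]
  rw [this]
  exact MeasurableSet.iInter fun k => MeasurableSet.iInter fun _ =>
    measurable_pi_apply k trivial

lemma cylAt_eq_biUnion (hm : ∀ k, 2 ≤ m k) (n : ℕ) (x : Gm m) :
    cylAt m n x = ⋃ a ∈ range (m n), cylAt m (n + 1) (Function.update x n (a : ZMod (m n))) := by
  have : NeZero (m n) := ⟨by have := hm n; omega⟩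
  ext y
  simp only [cylAt, Set.mem_ofPred_eq, Set.mem_iUnion, Finset.mem_range, exists_prop]
  constructor
  · refine fun h => ⟨(y n).val, ZMod.val_lt _, fun k hk => ?_⟩
    rcases Nat.lt_succ_iff_lt_or_eq.1 hk with hk | rfl
    · rw [Function.update_of_ne hk.ne, h k hk]
    · rw [Function.update_self, ZMod.natCast_zmod_val]
  · rintro ⟨a, _, h⟩ k hk
    rw [h k (by omega), Function.update_of_ne hk.ne]

lemma pairwiseDisjoint_cylAt_update (n : ℕ) (x : Gm m) :
    (↑(range (m n)) : Set ℕ).PairwiseDisjoint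
      fun a => cylAt m (n + 1) (Function.update x n (a : ZMod (m n))) := by
  intro a ha b hb hab
  refine Set.disjoint_left.2 fun y hya hyb => hab ?_
  have h1 := hya n (Nat.lt_succ_self n)
  have h2 := hyb n (Nat.lt_succ_self n)
  rw [Function.update_self] at h1 h2
  have h3 := congrArg ZMod.val (h1.symm.trans h2)
  rwa [ZMod.val_cast_of_lt (by simpa using ha), ZMod.val_cast_of_lt (by simpa using hb)] at h3

lemma DependsOnFirst.measurable (hm : ∀ k, 2 ≤ m k) {n : ℕ} {h : Gm m → ℂ}
    (hh : DependsOnFirst n h) : Measurable h ∧ (Set.range h).Finite := by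
  have hz : ∀ k, NeZero (m k) := fun k => ⟨by have := hm k; omega⟩
  have hs : ∀ k, MeasurableSingletonClass (ZMod (m k)) := fun k => ⟨fun _ => trivial⟩
  let π : Gm m → ∀ k : Fin n, ZMod (m k) := fun x k => x k
  let e : (∀ k : Fin n, ZMod (m k)) → Gm m := fun y k => if hk : k < n then y ⟨k, hk⟩ else 0
  have hfac : h = (h ∘ e) ∘ π := by
    funext x
    refine hh _ _ fun k hk => ?_
    simp [e, π, hk]
  have hfin : Finite (∀ k : Fin n, ZMod (m k)) := inferInstance
  constructor
  · rw [hfac]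
    exact (measurable_of_finite _).comp (measurable_pi_lambda _ fun k => measurable_pi_apply _)
  · rw [hfac]
    exact (Set.finite_range (h ∘ e)).subset (Set.range_comp_subset_range _ _)

variable {μ : Measure (Gm m)}

lemma IsHaar.isProbabilityMeasure (hμ : IsHaar m μ) : IsProbabilityMeasure μ := ⟨by
  have h := hμ 0 0
  have hu : cylAt m 0 (0 : Gm m) = Set.univ := by ext; simp [cylAt]
  simpa [hu, M] using h⟩

lemma DependsOnFirst.integrable (hm : ∀ k, 2 ≤ m k) (hμ : IsHaar m μ) {n : ℕ} {h : Gm m → ℂ}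
    (hh : DependsOnFirst n h) : Integrable h μ := by
  have := hμ.isProbabilityMeasure
  obtain ⟨h1, h2⟩ := hh.measurable hm
  obtain ⟨C, hC⟩ := h2.isBounded.exists_norm_le
  exact Integrable.of_bound h1.aestronglyMeasurable C (ae_of_all _ fun x => hC _ ⟨x, rfl⟩)

lemma setIntegral_cylAt_self (hμ : IsHaar m μ) {n : ℕ} {h : Gm m → ℂ}
    (hh : DependsOnFirst n h) (x : Gm m) :
    ∫ t in cylAt m n x, h t ∂μ = (M m n : ℂ)⁻¹ * h x := by
  rw [setIntegral_congr_fun (measurableSet_cylAt n x) (fun y hy => hh y x hy), setIntegral_const,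
    measureReal_def, hμ n x]
  simp

lemma setIntegral_cylAt_succ (hm : ∀ k, 2 ≤ m k) {h : Gm m → ℂ} (hh : Integrable h μ)
    (n : ℕ) (x : Gm m) :
    ∫ t in cylAt m n x, h t ∂μ = ∑ a ∈ range (m n),
      ∫ t in cylAt m (n + 1) (Function.update x n (a : ZMod (m n))), h t ∂μ := by
  rw [cylAt_eq_biUnion hm n x]
  exact integral_biUnion_finset _ (fun _ _ => measurableSet_cylAt _ _)
    (pairwiseDisjoint_cylAt_update n x) fun _ _ => hh.integrableOn

/-- Averaging over the coordinate `N` does not change integrals over cylinders of length at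
most `N`. -/
lemma setIntegral_cylAt_avg (hm : ∀ k, 2 ≤ m k) (hμ : IsHaar m μ) {n N : ℕ} (hnN : n ≤ N)
    {g h : Gm m → ℂ} (hg : DependsOnFirst N g) (hh : DependsOnFirst (N + 1) h)
    (hgh : ∀ x, ∑ a ∈ range (m N), h (Function.update x N (a : ZMod (m N))) = m N * g x)
    (x : Gm m) : ∫ t in cylAt m n x, h t ∂μ = ∫ t in cylAt m n x, g t ∂μ := by
  induction hnN using Nat.decreasingInduction generalizing x with
  | self =>
    rw [setIntegral_cylAt_succ hm (hh.integrable hm hμ), setIntegral_cylAt_self hμ hg,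
      Finset.sum_congr rfl fun a _ => setIntegral_cylAt_self hμ hh _, ← Finset.mul_sum, hgh, M]
    have : (m N : ℂ) ≠ 0 := by have := hm N; exact_mod_cast (by omega)
    push_cast
    field_simp
  | of_succ n hn ih =>
    rw [setIntegral_cylAt_succ hm (hh.integrable hm hμ),
      setIntegral_cylAt_succ hm (hg.integrable hm hμ)]
    exact Finset.sum_congr rfl fun a _ => ih _

lemma integral_avg (hm : ∀ k, 2 ≤ m k) (hμ : IsHaar m μ) {N : ℕ}
    {g h : Gm m → ℂ} (hg : DependsOnFirst N g) (hh : DependsOnFirst (N + 1) h)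
    (hgh : ∀ x, ∑ a ∈ range (m N), h (Function.update x N (a : ZMod (m N))) = m N * g x) :
    ∫ t, h t ∂μ = ∫ t, g t ∂μ := by
  have hu : cylAt m 0 (0 : Gm m) = Set.univ := by ext; simp [cylAt]
  simpa [hu] using setIntegral_cylAt_avg hm hμ (Nat.zero_le N) hg hh hgh 0

lemma integral_vil_mul_conj (hm : ∀ k, 2 ≤ m k) (hμ : IsHaar m μ) {N i j : ℕ}
    (hi : i < M m N) (hj : j < M m N) :
    ∫ x, vil m i x * (starRingEnd ℂ) (vil m j x) ∂μ = if i = j then 1 else 0 := by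
  have := hμ.isProbabilityMeasure
  have hself : ∀ i, ∀ x : Gm m, vil m i x * (starRingEnd ℂ) (vil m i x) = 1 := fun i x => by
    rw [Complex.mul_conj, Complex.normSq_eq_norm_sq, norm_vil]; simp
  split_ifs with hij
  · subst hij
    simp [hself]
  induction N generalizing i j with
  | zero => simp [M] at hi hj; omega
  | succ N ih =>
    have hM := M_pos hm N
    have hic : i / M m N < m N := Nat.div_lt_of_lt_mul (by rwa [M, mul_comm] at hi)
    have hjc : j / M m N < m N := Nat.div_lt_of_lt_mul (by rwa [M, mul_comm] at hj)
    have hir := Nat.mod_lt i hM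
    have hjr := Nat.mod_lt j hM
    have hi' := Nat.div_add_mod' i (M m N)
    have hj' := Nat.div_add_mod' j (M m N)
    have hmul : ∀ x, vil m i x * (starRingEnd ℂ) (vil m j x)
        = (rad m N x ^ (i / M m N) * (starRingEnd ℂ) (rad m N x) ^ (j / M m N)) *
          (vil m (i % M m N) x * (starRingEnd ℂ) (vil m (j % M m N) x)) := fun x => by
      rw [← hi', ← hj', vil_add hm hir hic, vil_add hm hjr hjc, hi', hj', map_mul, map_pow]
      ring
    have hdep := (dependsOnFirst_vil hm hi).mul (dependsOnFirst_vil hm hj).conj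
    have hdep' := (dependsOnFirst_vil hm hir).mul (dependsOnFirst_vil hm hjr).conj
    by_cases hc : i / M m N = j / M m N
    · have hr : i % M m N ≠ j % M m N := fun h => hij (by rw [← hi', ← hj', hc, h])
      rw [← ih hir hjr hr]
      refine integral_avg hm hμ hdep' hdep fun x => ?_
      have : ∀ a ∈ range (m N), vil m i (Function.update x N (a : ZMod (m N))) *
          (starRingEnd ℂ) (vil m j (Function.update x N (a : ZMod (m N))))
          = vil m (i % M m N) x * (starRingEnd ℂ) (vil m (j % M m N) x) := fun a _ => by
        rw [hmul, hdep'.update, hc, ← mul_pow, Complex.mul_conj, Complex.normSq_eq_norm_sq,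
          norm_rad]
        simp
      rw [Finset.sum_congr rfl this]
      simp
    · rw [← integral_zero (Gm m) ℂ (μ := μ)]
      refine integral_avg hm hμ (dependsOnFirst_const N 0) hdep fun x => ?_
      simp only [hmul, hdep'.update]
      rw [← Finset.sum_mul, sum_update_rad hm hic hjc hc, zero_mul, mul_zero]

end Measure

section Lacunary

/-- The coefficient `β_α / M_α` for `M_α ≤ j < 2 M_α`, and `0` for all other `j`. -/
def lacCoeff (m : ℕ → ℕ) (β : ℕ → ℝ) (j : ℕ) : ℝ :=
  ∑ a ∈ range (j + 1), if M m a ≤ j ∧ j < 2 * M m a then β a / M m a else 0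

/-- The partial sums of the Vilenkin series with coefficients `lacCoeff m β`. -/
def lacSum (m : ℕ → ℕ) (β : ℕ → ℝ) (n : ℕ) (x : Gm m) : ℂ :=
  ∑ j ∈ range n, lacCoeff m β j • vil m j x

/-- The martingale of the Vilenkin series with coefficients `lacCoeff m β`. -/
def lacMart (m : ℕ → ℕ) (β : ℕ → ℝ) (n : ℕ) : Gm m → ℂ := lacSum m β (M m n)

variable {β : ℕ → ℝ}

lemma lacCoeff_eq (hm : ∀ k, 2 ≤ m k) {a j : ℕ} (h1 : M m a ≤ j) (h2 : j < M m (a + 1)) :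
    lacCoeff m β j = if j < 2 * M m a then β a / M m a else 0 := by
  rw [lacCoeff, Finset.sum_eq_single a]
  · simp [h1]
  · intro b _ hb
    refine if_neg fun h => ?_
    rcases lt_or_gt_of_ne hb with hb | hb
    · have := two_mul_M_le hm b
      have : M m (b + 1) ≤ M m a := M_mono hm hb
      omega
    · have : M m (a + 1) ≤ M m b := M_mono hm hb
      omega
  · intro h
    have := lt_M hm a
    simp at h
    omega

lemma lacCoeff_nonneg (hβ : ∀ a, 0 ≤ β a) (j : ℕ) : 0 ≤ lacCoeff m β j :=
  Finset.sum_nonneg fun a _ => by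
    split_ifs
    · exact div_nonneg (hβ a) (Nat.cast_nonneg _)
    · exact le_rfl

variable {E : Type*} [AddCommGroup E] [Module ℝ E]

lemma sum_lacCoeff_add (hm : ∀ k, 2 ≤ m k) (w : ℕ → E) {a i : ℕ} (hi : i ≤ M m a) :
    ∑ j ∈ range (M m a + i), lacCoeff m β j • w j
      = ∑ j ∈ range (M m a), lacCoeff m β j • w j
        + (β a / M m a) • ∑ j ∈ range i, w (M m a + j) := by
  rw [Finset.sum_range_add, Finset.smul_sum]
  congr 1
  refine Finset.sum_congr rfl fun j hj => ?_
  have hj := Finset.mem_range.1 hj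
  have := two_mul_M_le hm a
  rw [lacCoeff_eq hm (a := a) (by omega) (by omega), if_pos (by omega)]

lemma sum_lacCoeff_succ (hm : ∀ k, 2 ≤ m k) (w : ℕ → E) (a : ℕ) :
    ∑ j ∈ range (M m (a + 1)), lacCoeff m β j • w j
      = ∑ j ∈ range (M m a), lacCoeff m β j • w j
        + (β a / M m a) • ∑ j ∈ range (M m a), w (M m a + j) := by
  rw [← sum_lacCoeff_add hm w le_rfl]
  symm
  have h2 := two_mul_M_le hm a
  refine Finset.sum_subset (Finset.range_mono (by omega)) fun j hj hj' => ?_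
  simp only [Finset.mem_range, not_lt] at hj hj'
  rw [lacCoeff_eq hm (a := a) (by omega) hj, if_neg (by omega), zero_smul]

lemma lacCoeff_zero (hm : ∀ k, 2 ≤ m k) : lacCoeff m β 0 = 0 := by
  refine Finset.sum_eq_zero fun a _ => if_neg fun h => ?_
  have := M_pos hm a
  omega

lemma sum_lacCoeff_M (hm : ∀ k, 2 ≤ m k) (a : ℕ) :
    ∑ j ∈ range (M m a), lacCoeff m β j = ∑ i ∈ range a, β i := by
  induction a with
  | zero => simp [M, lacCoeff_zero hm]
  | succ a ih =>
    have h := sum_lacCoeff_succ (β := β) hm (fun _ => (1 : ℝ)) a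
    simp only [smul_eq_mul, mul_one, Finset.sum_const, Finset.card_range, nsmul_eq_mul] at h
    have h0 : (M m a : ℝ) ≠ 0 := by exact_mod_cast (M_pos hm a).ne'
    rw [h, ih, Finset.sum_range_succ, div_mul_cancel₀ _ h0]

lemma lacSum_add (hm : ∀ k, 2 ≤ m k) {a i : ℕ} (hi : i ≤ M m a) (x : Gm m) :
    lacSum m β (M m a + i) x
      = lacSum m β (M m a) x + (β a / M m a : ℝ) * rad m a x * D m i x := by
  rw [lacSum, sum_lacCoeff_add hm _ hi, ← lacSum, Complex.real_smul, mul_assoc, D,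
    Finset.mul_sum _ _ (rad m a x)]
  congr 2
  exact Finset.sum_congr rfl fun j hj => vil_M_add hm ((Finset.mem_range.1 hj).trans_le hi) x

lemma norm_lacSum_le (hm : ∀ k, 2 ≤ m k) (hβ : ∀ a, 0 ≤ β a) {a n : ℕ} (hn : n ≤ M m a)
    (x : Gm m) : ‖lacSum m β n x‖ ≤ ∑ i ∈ range a, β i := by
  rw [← sum_lacCoeff_M hm]
  refine (norm_sum_le _ _).trans ?_
  refine le_trans (le_of_eq ?_) (Finset.sum_le_sum_of_subset_of_nonneg (Finset.range_mono hn)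
    fun j _ _ => lacCoeff_nonneg hβ j)
  refine Finset.sum_congr rfl fun j _ => ?_
  rw [norm_smul, norm_vil, mul_one, Real.norm_of_nonneg (lacCoeff_nonneg hβ j)]

lemma lacMart_succ (hm : ∀ k, 2 ≤ m k) (n : ℕ) (x : Gm m) :
    lacMart m β (n + 1) x
      = lacMart m β n x + (β n / M m n : ℝ) * rad m n x * D m (M m n) x := by
  rw [lacMart, lacMart, ← lacSum_add hm le_rfl, lacSum, sum_lacCoeff_succ hm, lacSum,
    sum_lacCoeff_add hm _ le_rfl]

lemma dependsOnFirst_lacMart (hm : ∀ k, 2 ≤ m k) (n : ℕ) :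
    DependsOnFirst n (lacMart m β n) := fun x y hxy => by
  rw [lacMart, lacSum, lacSum]
  refine Finset.sum_congr rfl fun j hj => ?_
  rw [dependsOnFirst_vil hm (Finset.mem_range.1 hj) x y hxy]

variable {μ : Measure (Gm m)}

lemma isMartingale_lacMart (hm : ∀ k, 2 ≤ m k) (hμ : IsHaar m μ) :
    IsMartingale m μ (lacMart m β) where
  integrable n := (dependsOnFirst_lacMart hm n).integrable hm hμ
  adapted n := dependsOnFirst_lacMart hm n
  mart n N hnN x := by
    have hM : (M m n : ℂ) ≠ 0 := by exact_mod_cast (M_pos hm n).ne'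
    induction N, hnN using Nat.le_induction with
    | base => rw [setIntegral_cylAt_self hμ (dependsOnFirst_lacMart hm n), mul_inv_cancel_left₀ hM]
    | succ N hN ih =>
      rw [ih, setIntegral_cylAt_avg hm hμ hN (dependsOnFirst_lacMart hm N)
        (dependsOnFirst_lacMart hm (N + 1))]
      intro y
      have hD : DependsOnFirst N (D m (M m N)) := DependsOnFirst.sum fun j hj =>
        dependsOnFirst_vil hm (Finset.mem_range.1 hj)
      have h0 := sum_update_rad hm (k := N) (c := 1) (d := 0) (hm N)
        (by have := hm N; omega) one_ne_zero y
      simp only [pow_one, pow_zero, mul_one] at h0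
      simp only [lacMart_succ hm, (dependsOnFirst_lacMart hm N).update, hD.update]
      rw [Finset.sum_add_distrib, ← Finset.sum_mul, ← Finset.mul_sum, h0]
      simp

lemma coeff_lacMart (hm : ∀ k, 2 ≤ m k) (hμ : IsHaar m μ) (i : ℕ) :
    coeff m μ (lacMart m β) i = lacCoeff m β i := by
  have hi : i < M m (i + 1) := (Nat.lt_succ_self i).trans (lt_M hm _)
  simp only [coeff, lacMart, lacSum, Finset.sum_mul, smul_mul_assoc]
  rw [integral_finsetSum]
  · rw [Finset.sum_eq_single_of_mem i (Finset.mem_range.2 hi)]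
    · rw [integral_smul, integral_vil_mul_conj hm hμ hi hi, if_pos rfl, Complex.real_smul, mul_one]
    · intro j hj hji
      rw [integral_smul, integral_vil_mul_conj hm hμ (Finset.mem_range.1 hj) hi, if_neg hji,
        smul_zero]
  · intro j hj
    exact (((dependsOnFirst_vil hm (Finset.mem_range.1 hj)).mul
      (dependsOnFirst_vil hm hi).conj).integrable hm hμ).smul (lacCoeff m β j)

lemma S_lacMart (hm : ∀ k, 2 ≤ m k) (hμ : IsHaar m μ) (n : ℕ) (x : Gm m) :
    S m μ (lacMart m β) n x = lacSum m β n x := by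
  simp only [S, lacSum, coeff_lacMart hm hμ, Complex.real_smul]

/-- The Fejér mean of order `M_a + s` is, up to a bounded error, a multiple of `s K_s`. -/
lemma norm_sumD_le_norm_sigma (hm : ∀ k, 2 ≤ m k) (hμ : IsHaar m μ) (hβ : ∀ a, 0 ≤ β a)
    {a s : ℕ} (hs : s ≤ M m a) (x : Gm m) :
    β a / (2 * (M m a : ℝ) ^ 2) * ‖sumD m s x‖
      ≤ ‖sigma m μ (lacMart m β) (M m a + s) x‖ + ∑ i ∈ range a, β i := by
  have hM : (0 : ℝ) < M m a := by exact_mod_cast M_pos hm a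
  set B := ∑ i ∈ range a, β i with hB
  have hB0 : 0 ≤ B := Finset.sum_nonneg fun i _ => hβ i
  set n : ℝ := M m a + s with hn
  have hs' : (s : ℝ) ≤ M m a := by exact_mod_cast hs
  have hn0 : 0 < n := by positivity
  set u := ∑ k ∈ range (M m a), lacSum m β (k + 1) x + s * lacSum m β (M m a) x with hu
  have hsig : (n : ℂ) * sigma m μ (lacMart m β) (M m a + s) x
      = u + (β a / M m a : ℝ) * rad m a x * sumD m s x := by
    have hnc : ((M m a + s : ℕ) : ℂ) = (n : ℂ) := by rw [hn]; push_cast; rfl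
    have hn0' : (n : ℂ) ≠ 0 := by exact_mod_cast hn0.ne'
    rw [sigma, hnc, mul_inv_cancel_left₀ hn0']
    simp only [S_lacMart hm hμ]
    rw [Finset.sum_range_add, hu, add_assoc, sumD, Finset.mul_sum]
    have : ∀ k ∈ range s, lacSum m β (M m a + k + 1) x
        = lacSum m β (M m a) x + (β a / M m a : ℝ) * rad m a x * D m (k + 1) x := fun k hk => by
      rw [add_assoc, lacSum_add hm ((Nat.succ_le_of_lt (Finset.mem_range.1 hk)).trans hs)]
    rw [Finset.sum_congr rfl this, Finset.sum_add_distrib, Finset.sum_const, Finset.card_range,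
      nsmul_eq_mul]
  have hub : ‖u‖ ≤ n * B := by
    rw [hn, add_mul]
    refine (norm_add_le _ _).trans (add_le_add ?_ ?_)
    · refine (norm_sum_le _ _).trans ?_
      refine (Finset.sum_le_card_nsmul _ _ B fun k hk => ?_).trans (by simp)
      exact norm_lacSum_le hm hβ (Nat.succ_le_of_lt (Finset.mem_range.1 hk)) x
    · rw [norm_mul, Complex.norm_natCast]
      exact mul_le_mul_of_nonneg_left (norm_lacSum_le hm hβ le_rfl x) (Nat.cast_nonneg _)
  have h1 : β a / M m a * ‖sumD m s x‖ ≤ n * (‖sigma m μ (lacMart m β) (M m a + s) x‖ + B) := by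
    have h2 : ((β a / M m a : ℝ) : ℂ) * rad m a x * sumD m s x
        = (n : ℂ) * sigma m μ (lacMart m β) (M m a + s) x - u := by rw [hsig]; ring
    have h3 := congrArg norm h2
    rw [norm_mul, norm_mul, norm_rad, mul_one, Complex.norm_real,
      Real.norm_of_nonneg (div_nonneg (hβ a) hM.le)] at h3
    rw [h3, mul_add]
    refine (norm_sub_le _ _).trans (add_le_add ?_ hub)
    rw [norm_mul, Complex.norm_real, Real.norm_of_nonneg hn0.le]
  have h4 : n * (‖sigma m μ (lacMart m β) (M m a + s) x‖ + B)
      ≤ (2 * M m a) * (‖sigma m μ (lacMart m β) (M m a + s) x‖ + B) :=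
    mul_le_mul_of_nonneg_right (by linarith) (by positivity)
  have h5 : β a / (2 * (M m a : ℝ) ^ 2) * ‖sumD m s x‖
      = (β a / M m a * ‖sumD m s x‖) / (2 * M m a) := by field_simp
  rw [h5, div_le_iff₀ (by positivity)]
  linarith

lemma enorm_lacMart_le (hm : ∀ k, 2 ≤ m k) (hβ : ∀ a, 0 ≤ β a) (n : ℕ) (x : Gm m) :
    ‖lacMart m β n x‖ₑ
      ≤ ∑ a ∈ range n, (cylAt m a 0).indicator (fun _ => ENNReal.ofReal (β a)) x := by
  induction n with
  | zero => simp [lacMart, lacSum, M, lacCoeff_zero hm]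
  | succ n ih =>
    rw [lacMart_succ hm, Finset.sum_range_succ]
    refine (enorm_add_le _ _).trans (add_le_add ih (le_of_eq ?_))
    rw [D_M_eq_indicator hm]
    have hM : (0 : ℝ) < M m n := by exact_mod_cast M_pos hm n
    by_cases h : x ∈ cylAt m n 0
    · rw [Set.indicator_of_mem h, Set.indicator_of_mem h, ← ofReal_norm, norm_mul,
        norm_mul, norm_rad, mul_one, Complex.norm_real, Complex.norm_natCast,
        Real.norm_of_nonneg (div_nonneg (hβ n) hM.le), div_mul_cancel₀ _ hM.ne']
    · rw [Set.indicator_of_notMem h, Set.indicator_of_notMem h, mul_zero, enorm_zero]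

lemma ennreal_sum_rpow_le {ι : Type*} (s : Finset ι) (f : ι → ℝ≥0∞) {p : ℝ} (hp : 0 < p)
    (hp1 : p ≤ 1) : (∑ i ∈ s, f i) ^ p ≤ ∑ i ∈ s, f i ^ p := by
  classical
  induction s using Finset.induction_on with
  | empty => simp [hp]
  | insert i s hi ih =>
    rw [Finset.sum_insert hi, Finset.sum_insert hi]
    exact (ENNReal.rpow_add_le_add_rpow _ _ hp.le hp1).trans (by gcongr)

lemma memHp_lacMart (hm : ∀ k, 2 ≤ m k) (hμ : IsHaar m μ) (hβ : ∀ a, 0 ≤ β a) {p : ℝ}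
    (hp : 0 < p) (hp1 : p ≤ 1) {C : ℝ} (hC : ∀ n, ∑ a ∈ range n, β a ^ p / M m a ≤ C) :
    MemHp m μ p (lacMart m β) := by
  have hle : ∀ x, mstar m (lacMart m β) x ^ p
      ≤ ∑' a, (cylAt m a 0).indicator (fun _ => ENNReal.ofReal (β a ^ p)) x := fun x => by
    rw [← ENNReal.le_rpow_inv_iff hp]
    refine iSup_le fun n => ?_
    rw [ENNReal.le_rpow_inv_iff hp]
    calc (‖lacMart m β n x‖₊ : ℝ≥0∞) ^ p
        ≤ (∑ a ∈ range n, (cylAt m a 0).indicator (fun _ => ENNReal.ofReal (β a)) x) ^ p :=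
          ENNReal.rpow_le_rpow (enorm_lacMart_le hm hβ n x) hp.le
      _ ≤ ∑ a ∈ range n, ((cylAt m a 0).indicator (fun _ => ENNReal.ofReal (β a)) x) ^ p :=
          ennreal_sum_rpow_le _ _ hp hp1
      _ = ∑ a ∈ range n, (cylAt m a 0).indicator (fun _ => ENNReal.ofReal (β a ^ p)) x := by
          refine Finset.sum_congr rfl fun a _ => ?_
          by_cases h : x ∈ cylAt m a 0
          · simp only [Set.indicator_of_mem h, ENNReal.ofReal_rpow_of_nonneg (hβ a) hp.le]
          · simp only [Set.indicator_of_notMem h, ENNReal.zero_rpow_of_pos hp]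
      _ ≤ _ := ENNReal.sum_le_tsum _
  have hint : ∫⁻ x, mstar m (lacMart m β) x ^ p ∂μ ≤ ENNReal.ofReal C := by
    refine (lintegral_mono hle).trans ?_
    rw [lintegral_tsum fun a => (measurable_const.indicator (measurableSet_cylAt a 0)).aemeasurable]
    refine ENNReal.tsum_le_of_sum_range_le fun n => ?_
    refine le_trans (le_of_eq ?_) (ENNReal.ofReal_le_ofReal (hC n))
    rw [ENNReal.ofReal_sum_of_nonneg fun a _ =>
      div_nonneg (Real.rpow_nonneg (hβ a) p) (Nat.cast_nonneg _)]
    refine Finset.sum_congr rfl fun a _ => ?_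
    rw [lintegral_indicator_const (measurableSet_cylAt a 0), hμ a 0,
      ENNReal.ofReal_div_of_pos (by exact_mod_cast M_pos hm a), ENNReal.ofReal_natCast,
      div_eq_mul_inv]
  exact ENNReal.rpow_ne_top_of_nonneg (by positivity) (hint.trans_lt ENNReal.ofReal_lt_top).ne

end Lacunary

section Divergence

/-- Greedy selection: at each place `a` that is good for the current stage `k` and the current
partial sum `B`, the sequence takes the value `b k a` and moves on to the next stage. -/
lemma exists_greedy_sequence (G : ℕ → ℝ → ℕ → Prop) (b : ℕ → ℕ → ℝ)
    (hG : ∀ k B, ∀ᶠ a in Filter.atTop, G k B a) :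
    ∃ (κ : ℕ → ℕ) (β : ℕ → ℝ), κ 0 = 0 ∧
      (∀ a, (β a = 0 ∧ κ (a + 1) = κ a) ∨ (β a = b (κ a) a ∧ κ (a + 1) = κ a + 1)) ∧
      ∀ k, ∃ a, G k (∑ i ∈ range a, β i) a ∧ β a = b k a := by
  classical
  let st : ℕ → ℕ × ℝ := fun n => Nat.rec (0, 0)
    (fun a q => if G q.1 q.2 a then (q.1 + 1, q.2 + b q.1 a) else q) n
  have hst : ∀ a, st (a + 1) = if G (st a).1 (st a).2 a
      then ((st a).1 + 1, (st a).2 + b (st a).1 a) else st a := fun a => rfl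
  let β : ℕ → ℝ := fun a => if G (st a).1 (st a).2 a then b (st a).1 a else 0
  have hsum : ∀ a, ∑ i ∈ range a, β i = (st a).2 := fun a => by
    induction a with
    | zero => simp [st]
    | succ a ih =>
      rw [Finset.sum_range_succ, ih, hst]
      by_cases h : G (st a).1 (st a).2 a <;> simp [β, h]
  have hjump : ∀ a₀, ∃ a, a₀ ≤ a ∧ st a = st a₀ ∧ G (st a₀).1 (st a₀).2 a := fun a₀ => by
    obtain ⟨N, hN⟩ := Filter.eventually_atTop.1 (hG (st a₀).1 (st a₀).2)
    have hex : ∃ a, a₀ ≤ a ∧ G (st a₀).1 (st a₀).2 a :=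
      ⟨max a₀ N, le_max_left _ _, hN _ (le_max_right _ _)⟩
    obtain ⟨h1, h2⟩ := Nat.find_spec hex
    refine ⟨Nat.find hex, h1, ?_, h2⟩
    have : ∀ a, a₀ ≤ a → a ≤ Nat.find hex → st a = st a₀ := fun a ha => by
      induction a, ha using Nat.le_induction with
      | base => exact fun _ => rfl
      | succ a ha ih =>
        intro hlt
        have hn := Nat.find_min hex (m := a) (by omega)
        rw [hst, ih (by omega), if_neg fun hg => hn ⟨ha, hg⟩]
    exact this _ h1 le_rfl
  refine ⟨fun a => (st a).1, β, rfl, fun a => ?_, fun k => ?_⟩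
  · by_cases h : G (st a).1 (st a).2 a
    · right; simp [β, h, hst]
    · left; simp [β, h, hst]
  · have hk : ∀ k, ∃ a, (st a).1 = k := fun k => by
      induction k with
      | zero => exact ⟨0, rfl⟩
      | succ k ih =>
        obtain ⟨a₀, rfl⟩ := ih
        obtain ⟨a, _, h1, h2⟩ := hjump a₀
        refine ⟨a + 1, ?_⟩
        rw [hst, h1, if_pos h2]
    obtain ⟨a₀, rfl⟩ := hk k
    obtain ⟨a, _, h1, h2⟩ := hjump a₀
    refine ⟨a, ?_, ?_⟩
    · rw [hsum, h1]; exact h2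
    · simp only [β, h1, if_pos h2]

variable {μ : Measure (Gm m)}

/-- A gliding-hump principle: if `Φ` can be made large by multiples of the functions `s K_s`,
uniformly with respect to bounded perturbations, then the Fejér means of some martingale in
`H_p` are unbounded with respect to `Φ`. -/
lemma exists_memHp_iSup_eq_top (hm : ∀ k, 2 ≤ m k) (hμ : IsHaar m μ) {p : ℝ} (hp : 0 < p)
    (hp1 : p ≤ 1) (Φ : (Gm m → ℂ) → ℝ≥0∞)
    (hΦ : ∀ (k : ℕ) (B : ℝ), ∀ᶠ a in Filter.atTop, ∃ s ≤ M m a, ∀ g : Gm m → ℂ,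
      (∀ x, ((1 / 2) ^ k * (M m a : ℝ)) ^ (1 / p) / (2 * (M m a : ℝ) ^ 2) * ‖sumD m s x‖
        ≤ ‖g x‖ + B) → (k : ℝ≥0∞) ≤ Φ g) :
    ∃ f : ℕ → Gm m → ℂ, IsMartingale m μ f ∧ MemHp m μ p f ∧
      ⨆ n : ℕ, Φ (sigma m μ f (n + 1)) = ⊤ := by
  obtain ⟨κ, β, h0, hstep, hgood⟩ := exists_greedy_sequence _
    (fun k a => ((1 / 2) ^ k * (M m a : ℝ)) ^ (1 / p)) hΦ
  have hβ : ∀ a, 0 ≤ β a := fun a => by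
    rcases hstep a with h | h <;> rw [h.1]
    positivity
  have hsum : ∀ n, ∑ a ∈ range n, β a ^ p / M m a ≤ 2 - 2 * (1 / 2 : ℝ) ^ κ n := fun n => by
    induction n with
    | zero => simp [h0]
    | succ n ih =>
      have hM : (0 : ℝ) < M m n := by exact_mod_cast M_pos hm n
      rw [Finset.sum_range_succ]
      rcases hstep n with ⟨h1, h2⟩ | ⟨h1, h2⟩
      · rw [h1, h2, Real.zero_rpow hp.ne', zero_div, add_zero]
        exact ih
      · rw [h1, h2, ← Real.rpow_mul (by positivity), one_div_mul_cancel hp.ne', Real.rpow_one,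
          mul_div_cancel_right₀ _ hM.ne', pow_succ]
        linarith
  refine ⟨lacMart m β, isMartingale_lacMart hm hμ,
    memHp_lacMart hm hμ hβ hp hp1 (C := 2) fun n => (hsum n).trans ?_, ?_⟩
  · have : (0 : ℝ) ≤ 2 * (1 / 2) ^ κ n := by positivity
    linarith
  · refine ENNReal.eq_top_of_forall_nnreal_le fun r => ?_
    obtain ⟨k, hk⟩ := exists_nat_ge r
    obtain ⟨a, ⟨s, hs, hg⟩, hb⟩ := hgood k
    have h := hg (sigma m μ (lacMart m β) (M m a + s)) fun x => by
      rw [← hb]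
      exact norm_sumD_le_norm_sigma hm hμ hβ hs x
    have hn : M m a + s - 1 + 1 = M m a + s := by have := M_pos hm a; omega
    refine le_trans ?_ (le_iSup (fun n : ℕ => Φ (sigma m μ (lacMart m β) (n + 1)))
      (M m a + s - 1))
    simp only [hn]
    exact le_trans (by exact_mod_cast hk) h

lemma M_add_three_le {lam : ℕ} (hlam : ∀ k, m k ≤ lam) (n : ℕ) :
    M m (n + 3) ≤ lam ^ 3 * M m n := by
  calc M m (n + 3) = m (n + 2) * m (n + 1) * m n * M m n := by simp only [M]; ring
    _ ≤ lam * lam * lam * M m n := by gcongr <;> exact hlam _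
    _ = lam ^ 3 * M m n := by ring

/-- The functions `s K_s` are unbounded in `L_{1/2}`. -/
lemma le_lintegral_sumD_sparse {lam : ℕ} (hm : ∀ k, 2 ≤ m k) (hlam : ∀ k, m k ≤ lam)
    (hμ : IsHaar m μ) (N : ℕ) :
    ENNReal.ofReal (N / (2 * (lam : ℝ) ^ 3))
      ≤ ∫⁻ x, ENNReal.ofReal (‖sumD m (sparse m N) x‖ ^ (1 / 2 : ℝ)) ∂μ := by
  let y : ℕ → Gm m := fun i k => if k = 3 * i + 1 ∨ k = 3 * i + 2 then 1 else 0
  have h10 : ∀ k, (1 : ZMod (m k)) ≠ 0 := fun k => by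
    have : Fact (1 < m k) := ⟨hm k⟩
    exact one_ne_zero
  let C : ℕ → Set (Gm m) := fun i => cylAt m (3 * i + 3) (y i)
  have hC0 : ∀ i, ∀ x ∈ C i, ∀ j < 3 * i + 1, x j = 0 := fun i x hx j hj => by
    rw [hx j (by omega)]; exact if_neg (by omega)
  have hC1 : ∀ i, ∀ x ∈ C i, x (3 * i + 1) ≠ 0 := fun i x hx => by
    rw [hx _ (by omega)]; simpa [y] using h10 _
  have hC2 : ∀ i, ∀ x ∈ C i, x (3 * i + 2) ≠ 0 := fun i x hx => by
    rw [hx _ (by omega)]; simpa [y] using h10 _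
  have hdisj : (↑(range N) : Set ℕ).PairwiseDisjoint C := by
    have : ∀ i j, i < j → Disjoint (C i) (C j) := fun i j hij =>
      Set.disjoint_left.2 fun x hi hj => hC1 i x hi (hC0 j x hj _ (by omega))
    intro i _ j _ hij
    rcases lt_or_gt_of_ne hij with h | h
    · exact this i j h
    · exact (this j i h).symm
  have hlam0 : (0 : ℝ) < lam := by
    have := (hm 0).trans (hlam 0)
    exact_mod_cast (by omega : 0 < lam)
  have hterm : ∀ i ∈ range N, ENNReal.ofReal (1 / (2 * (lam : ℝ) ^ 3))
      ≤ ∫⁻ x in C i, ENNReal.ofReal (‖sumD m (sparse m N) x‖ ^ (1 / 2 : ℝ)) ∂μ := by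
    intro i hi
    have hM : (0 : ℝ) < M m (3 * i) := by exact_mod_cast M_pos hm _
    have hM3 : (0 : ℝ) < M m (3 * i + 3) := by exact_mod_cast M_pos hm _
    have hle : (M m (3 * i + 3) : ℝ) ≤ lam ^ 3 * M m (3 * i) := by
      exact_mod_cast M_add_three_le hlam _
    calc ENNReal.ofReal (1 / (2 * (lam : ℝ) ^ 3))
        ≤ ENNReal.ofReal ((M m (3 * i) / 2) * (M m (3 * i + 3) : ℝ)⁻¹) := by
          refine ENNReal.ofReal_le_ofReal ?_
          rw [← div_eq_mul_inv, div_le_div_iff₀ (by positivity) hM3]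
          linarith
      _ = ∫⁻ _ in C i, ENNReal.ofReal (M m (3 * i) / 2) ∂μ := by
          rw [setLIntegral_const, hμ, ENNReal.ofReal_mul (by positivity),
            ENNReal.ofReal_inv_of_pos hM3, ENNReal.ofReal_natCast]
      _ ≤ _ := by
          refine setLIntegral_mono' (measurableSet_cylAt _ _) fun x hx => ?_
          refine ENNReal.ofReal_le_ofReal ?_
          have h := le_norm_sumD_sparse hm (Finset.mem_range.1 hi) (hC0 i x hx) (hC1 i x hx)
            (hC2 i x hx)
          rw [← Real.sqrt_eq_rpow]
          refine Real.le_sqrt_of_sq_le ?_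
          nlinarith
  calc ENNReal.ofReal (N / (2 * (lam : ℝ) ^ 3))
      = ∑ i ∈ range N, ENNReal.ofReal (1 / (2 * (lam : ℝ) ^ 3)) := by
        rw [Finset.sum_const, Finset.card_range, nsmul_eq_mul, ← ENNReal.ofReal_natCast,
          ← ENNReal.ofReal_mul (Nat.cast_nonneg _), mul_one_div]
    _ ≤ ∑ i ∈ range N, ∫⁻ x in C i, ENNReal.ofReal (‖sumD m (sparse m N) x‖ ^ (1 / 2 : ℝ)) ∂μ :=
        Finset.sum_le_sum hterm
    _ = ∫⁻ x in ⋃ i ∈ range N, C i,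
          ENNReal.ofReal (‖sumD m (sparse m N) x‖ ^ (1 / 2 : ℝ)) ∂μ :=
        (lintegral_biUnion_finset hdisj (fun _ _ => measurableSet_cylAt _ _) _).symm
    _ ≤ _ := setLIntegral_le_lintegral _ _

lemma le_eLp_half_of_le {lam : ℕ} (hm : ∀ k, 2 ≤ m k) (hlam : ∀ k, m k ≤ lam)
    (hμ : IsHaar m μ) (k : ℕ) (B : ℝ) : ∀ᶠ a in Filter.atTop, ∃ s ≤ M m a, ∀ g : Gm m → ℂ,
      (∀ x, ((1 / 2) ^ k * (M m a : ℝ)) ^ (1 / (1 / 2 : ℝ)) / (2 * (M m a : ℝ) ^ 2) *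
        ‖sumD m s x‖ ≤ ‖g x‖ + B) →
      (k : ℝ≥0∞) ≤ eLp m μ (1 / 2) (fun x => (‖g x‖₊ : ℝ≥0∞)) := by
  have := hμ.isProbabilityMeasure
  have hlam0 : (0 : ℝ) < lam := by
    have := (hm 0).trans (hlam 0)
    exact_mod_cast (by omega : 0 < lam)
  set c : ℝ := (((1 / 2) ^ k) ^ 2 / 2) ^ (1 / 2 : ℝ) with hc
  have hc0 : 0 < c := by positivity
  obtain ⟨N, hN⟩ := exists_nat_ge ((k + |B| ^ (1 / 2 : ℝ)) / (c / (2 * (lam : ℝ) ^ 3)))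
  rw [div_le_iff₀ (by positivity)] at hN
  filter_upwards [Filter.eventually_ge_atTop (3 * N)] with a ha
  refine ⟨sparse m N, (sparse_le hm N).trans (M_mono hm ha), fun g hg => ?_⟩
  have hM : (0 : ℝ) < M m a := by exact_mod_cast M_pos hm a
  have hpt : ∀ x, ENNReal.ofReal c * ENNReal.ofReal (‖sumD m (sparse m N) x‖ ^ (1 / 2 : ℝ))
      ≤ (‖g x‖₊ : ℝ≥0∞) ^ (1 / 2 : ℝ) + ENNReal.ofReal (|B| ^ (1 / 2 : ℝ)) := fun x => by
    have h1 : ((1 / 2 : ℝ) ^ k) ^ 2 / 2 * ‖sumD m (sparse m N) x‖ ≤ ‖g x‖ + |B| := by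
      refine le_trans (le_of_eq ?_) ((hg x).trans (by linarith [le_abs_self B]))
      have h2 : (1 / (1 / 2 : ℝ)) = ((2 : ℕ) : ℝ) := by norm_num
      rw [h2, Real.rpow_natCast]
      field_simp
    rw [← ENNReal.ofReal_mul hc0.le, hc, ← Real.mul_rpow (by positivity) (norm_nonneg _),
      ← ENNReal.ofReal_rpow_of_nonneg (by positivity) (by norm_num),
      ← ENNReal.ofReal_rpow_of_nonneg (abs_nonneg B) (by norm_num)]
    refine le_trans (ENNReal.rpow_le_rpow (ENNReal.ofReal_le_ofReal h1) (by norm_num)) ?_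
    rw [ENNReal.ofReal_add (norm_nonneg _) (abs_nonneg _), ofReal_norm]
    exact ENNReal.rpow_add_le_add_rpow _ _ (by norm_num) (by norm_num)
  have hint := lintegral_mono (μ := μ) hpt
  rw [lintegral_const_mul' _ _ ENNReal.ofReal_ne_top, lintegral_add_right _ measurable_const,
    lintegral_const, measure_univ, mul_one] at hint
  have hk : (k : ℝ≥0∞) ≤ ∫⁻ x, (‖g x‖₊ : ℝ≥0∞) ^ (1 / 2 : ℝ) ∂μ := by
    refine (ENNReal.add_le_add_iff_right
      (ENNReal.ofReal_ne_top (r := |B| ^ (1 / 2 : ℝ)))).1 (le_trans ?_ hint)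
    refine le_trans ?_ (mul_le_mul_right (le_lintegral_sumD_sparse hm hlam hμ N) _)
    rw [← ENNReal.ofReal_mul hc0.le, ← ENNReal.ofReal_natCast,
      ← ENNReal.ofReal_add (Nat.cast_nonneg _) (by positivity)]
    refine ENNReal.ofReal_le_ofReal (hN.trans (le_of_eq ?_))
    ring
  rw [eLp]
  refine le_trans ?_ (ENNReal.rpow_le_rpow hk (by norm_num))
  have h2 : (1 / (1 / 2 : ℝ)) = ((2 : ℕ) : ℝ) := by norm_num
  rw [h2, ENNReal.rpow_natCast]
  exact_mod_cast Nat.le_self_pow two_ne_zero k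

lemma le_wLp_of_le (hm : ∀ k, 2 ≤ m k) (hμ : IsHaar m μ) {p : ℝ} (hp : 0 < p)
    (hp2 : p < 1 / 2) (k : ℕ) (B : ℝ) :
    ∀ᶠ a in Filter.atTop, ∃ s ≤ M m a, ∀ g : Gm m → ℂ,
      (∀ x, ((1 / 2) ^ k * (M m a : ℝ)) ^ (1 / p) / (2 * (M m a : ℝ) ^ 2) * ‖sumD m s x‖
        ≤ ‖g x‖ + B) → (k : ℝ≥0∞) ≤ wLp m μ p (fun x => (‖g x‖₊ : ℝ≥0∞)) := by
  have := hμ.isProbabilityMeasure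
  have hMtop : Filter.Tendsto (fun a => (M m a : ℝ)) Filter.atTop Filter.atTop :=
    tendsto_natCast_atTop_atTop.comp
      (Filter.tendsto_atTop_mono (fun a => (lt_M hm a).le) Filter.tendsto_id)
  have hq : 0 < 1 / p - 2 := by
    rw [sub_pos, lt_div_iff₀ hp]; linarith
  have hc : 0 < ((1 / 2 : ℝ) ^ k) ^ (1 / p) / 2 := by positivity
  have hlim := ((tendsto_rpow_atTop hq).comp hMtop).const_mul_atTop hc
  filter_upwards [hlim.eventually_ge_atTop (k + 1 + B)] with a ha
  refine ⟨1, M_pos hm a, fun g hg => ?_⟩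
  have hM : (0 : ℝ) < M m a := by exact_mod_cast M_pos hm a
  have hlt : ∀ x, (k : ℝ) < ‖g x‖ := fun x => by
    have h1 := hg x
    have hF : sumD m 1 x = 1 := by
      rw [sumD_eq hm (k := 0) (M_pos hm 0) (by simp)]; norm_num
    rw [hF, norm_one, mul_one, Real.mul_rpow (by positivity) hM.le] at h1
    simp only [Function.comp_apply] at ha
    rw [Real.rpow_sub hM, Real.rpow_two] at ha
    have h2 : ((1 / 2 : ℝ) ^ k) ^ (1 / p) / 2 * ((M m a : ℝ) ^ (1 / p) / (M m a : ℝ) ^ 2)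
      = ((1 / 2 : ℝ) ^ k) ^ (1 / p) * (M m a : ℝ) ^ (1 / p) / (2 * (M m a : ℝ) ^ 2) := by
      field_simp
    linarith
  refine le_trans ?_ (le_iSup _ (k : ℝ≥0))
  have huniv : {x | ((k : ℝ≥0) : ℝ≥0∞) < (‖g x‖₊ : ℝ≥0∞)} = Set.univ := by
    refine Set.eq_univ_of_forall fun x => ?_
    have h : (k : ℝ≥0) < ‖g x‖₊ := by exact_mod_cast hlt x
    exact ENNReal.coe_lt_coe.2 h
  rw [huniv, measure_univ, ENNReal.one_rpow, mul_one]
  simp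

end Divergence

end Vilenkin

/-- (a) there is a martingale `f ∈ H_{1/2}` with
`sup_{n ≥ 1} ‖σ_n f‖_{L_{1/2}} = ∞`; (b) for every `0 < p < 1/2` there is a
martingale `f ∈ H_p` with `sup_{n ≥ 1} ‖σ_n f‖_{weak-L_p} = ∞`. -/
theorem statement13 (lam : ℕ) (m : ℕ → ℕ) (hm : ∀ k, 2 ≤ m k) (hlam : ∀ k, m k ≤ lam)
    (μ : Measure (Gm m)) (hμ : Vilenkin.IsHaar m μ) :
    (∃ f : ℕ → Gm m → ℂ, Vilenkin.IsMartingale m μ f ∧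
        Vilenkin.MemHp m μ (1 / 2) f ∧
        (⨆ n : ℕ, Vilenkin.eLp m μ (1 / 2)
          (fun x => (‖Vilenkin.sigma m μ f (n + 1) x‖₊ : ℝ≥0∞))) = ⊤) ∧
    ∀ p : ℝ, 0 < p → p < 1 / 2 →
      ∃ f : ℕ → Gm m → ℂ, Vilenkin.IsMartingale m μ f ∧
        Vilenkin.MemHp m μ p f ∧
        (⨆ n : ℕ, Vilenkin.wLp m μ p
          (fun x => (‖Vilenkin.sigma m μ f (n + 1) x‖₊ : ℝ≥0∞))) = ⊤ := by
  refine ⟨?_, fun p hp hp2 => ?_⟩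
  · exact Vilenkin.exists_memHp_iSup_eq_top hm hμ (by norm_num) (by norm_num)
      (fun g => Vilenkin.eLp m μ (1 / 2) fun x => (‖g x‖₊ : ℝ≥0∞))
      (Vilenkin.le_eLp_half_of_le hm hlam hμ)
  · exact Vilenkin.exists_memHp_iSup_eq_top hm hμ hp (by linarith)
      (fun g => Vilenkin.wLp m μ p fun x => (‖g x‖₊ : ℝ≥0∞))
      (Vilenkin.le_wLp_of_le hm hμ hp hp2)
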